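/- arXiv:1803.06627 — 2 statements merged into one kernel-verified Lean document; each statement's English description precedes it below -/
import Mathlib

section
/- Let R be a commutative ring, X a type, φ : X × X → R a function, and n, m, k natural numbers. For f : X^n → R and g : X^m → R define f⋆g : X^{n+m} → R by (f⋆g)(λ₁,…,λ_{n+m}) = Σ_{τ∈Sh(n,m)} f(λ_{τ(1)},…,λ_{τ(n)})·g(λ_{τ(n+1)},…,λ_{τ(n+m)})·∏_{s=1}^{n}∏_{t=n+1}^{n+m} φ(λ_{τ(s)},λ_{τ(t)}). Then for all f : X^n → R, g : X^m → R, h : X^k → R one has (f⋆g)⋆h = f⋆(g⋆h) as functions X^{n+m+k} → R, and both sides equal λ ↦ Σ_{π∈Sh(n,m,k)} f(λ_{π(1)},…,λ_{π(n)})·g(λ_{π(n+1)},…,λ_{π(n+m)})·h(λ_{π(n+m+1)},…,λ_{π(n+m+k)})·∏_{s=1}^{n}∏_{t=n+1}^{n+m+k} φ(λ_{π(s)},λ_{π(t)})·∏_{s=n+1}^{n+m}∏_{t=n+m+1}^{n+m+k} φ(λ_{π(s)},λ_{π(t)}). -/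
open scoped Classical

noncomputable section

/-- An `(n,m)`-shuffle: a permutation of `{1,…,n+m}` strictly increasing on the
first block `{1,…,n}` and on the second block `{n+1,…,n+m}`. -/
def IsShuffle (n m : ℕ) (τ : Equiv.Perm (Fin (n + m))) : Prop :=
  StrictMono (fun i : Fin n => τ (Fin.castAdd m i)) ∧
  StrictMono (fun j : Fin m => τ (Fin.natAdd n j))

/-- An `(n,m,k)`-shuffle: a permutation of `{1,…,n+m+k}` strictly increasing on each
of the three consecutive blocks of sizes `n`, `m`, `k`. -/
def IsShuffle3 (n m k : ℕ) (π : Equiv.Perm (Fin (n + m + k))) : Prop :=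
  StrictMono (fun i : Fin n => π (Fin.castAdd k (Fin.castAdd m i))) ∧
  StrictMono (fun j : Fin m => π (Fin.castAdd k (Fin.natAdd n j))) ∧
  StrictMono (fun t : Fin k => π (Fin.natAdd (n + m) t))

/-- The kernel shuffle product `f ⋆ g` with kernel `φ`. -/
def shuffleMul {R X : Type*} [CommRing R] (φ : X × X → R) {n m : ℕ}
    (f : (Fin n → X) → R) (g : (Fin m → X) → R) : (Fin (n + m) → X) → R :=
  fun lam =>
    ∑ τ ∈ Finset.univ.filter (fun τ : Equiv.Perm (Fin (n + m)) => IsShuffle n m τ),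
      f (fun s => lam (τ (Fin.castAdd m s))) *
      g (fun t => lam (τ (Fin.natAdd n t))) *
      ∏ s : Fin n, ∏ t : Fin m,
        φ (lam (τ (Fin.castAdd m s)), lam (τ (Fin.natAdd n t)))

/-- The permutation `σ ∘ (τ ⊕ id)` of `Fin q`, where `Fin q` is split into two blocks by `e`. -/
def blockMul {p q : ℕ} {β : Type*} (e : Fin p ⊕ β ≃ Fin q) (σ : Equiv.Perm (Fin q))
    (τ : Equiv.Perm (Fin p)) : Equiv.Perm (Fin q) :=
  σ * e.permCongr (Equiv.sumCongr τ (Equiv.refl β))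

lemma blockMul_inl {p q : ℕ} {β : Type*} (e : Fin p ⊕ β ≃ Fin q) (σ : Equiv.Perm (Fin q))
    (τ : Equiv.Perm (Fin p)) (x : Fin p) :
    blockMul e σ τ (e (Sum.inl x)) = σ (e (Sum.inl (τ x))) := by
  simp [blockMul]

lemma blockMul_inr {p q : ℕ} {β : Type*} (e : Fin p ⊕ β ≃ Fin q) (σ : Equiv.Perm (Fin q))
    (τ : Equiv.Perm (Fin p)) (y : β) :
    blockMul e σ τ (e (Sum.inr y)) = σ (e (Sum.inr y)) := by
  simp [blockMul]

/-- A permutation is determined by its factorization `σ ∘ (τ ⊕ id)` with `σ` increasing on the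
first block. -/
lemma blockMul_injective {p q : ℕ} {β : Type*} (e : Fin p ⊕ β ≃ Fin q)
    {σ σ' : Equiv.Perm (Fin q)} {τ τ' : Equiv.Perm (Fin p)}
    (hσ : StrictMono fun x => σ (e (Sum.inl x))) (hσ' : StrictMono fun x => σ' (e (Sum.inl x)))
    (h : blockMul e σ τ = blockMul e σ' τ') : σ = σ' ∧ τ = τ' := by
  have hl : ∀ x, σ (e (Sum.inl (τ x))) = σ' (e (Sum.inl (τ' x))) := fun x => by
    rw [← blockMul_inl, h, blockMul_inl]
  have hr : ∀ y, σ (e (Sum.inr y)) = σ' (e (Sum.inr y)) := fun y => by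
    rw [← blockMul_inr e σ τ, h, blockMul_inr]
  have hfun : (fun x => σ (e (Sum.inl x))) = fun x => σ' (e (Sum.inl x)) := by
    refine (StrictMono.range_inj hσ hσ').1 ?_
    rw [← τ.surjective.range_comp, ← τ'.surjective.range_comp fun x => σ' (e (Sum.inl x))]
    exact congrArg Set.range (funext hl)
  constructor
  · ext1 z
    obtain ⟨x | y, rfl⟩ := e.surjective z
    · exact congrFun hfun x
    · exact hr y
  · ext1 x
    exact hσ'.injective ((congrFun hfun (τ x)).symm.trans (hl x))

/-- Every permutation factors as `σ ∘ (τ ⊕ id)` with `σ` increasing on the first block. -/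
lemma exists_blockMul_eq {p q : ℕ} {β : Type*} (e : Fin p ⊕ β ≃ Fin q)
    (π : Equiv.Perm (Fin q)) :
    ∃ (σ : Equiv.Perm (Fin q)) (τ : Equiv.Perm (Fin p)),
      StrictMono (fun x => σ (e (Sum.inl x))) ∧ blockMul e σ τ = π := by
  let ρ := Tuple.sort fun x => π (e (Sum.inl x))
  refine ⟨blockMul e π ρ, ρ⁻¹, ?_, ?_⟩
  · simp only [blockMul_inl]
    refine (Tuple.monotone_sort fun x => π (e (Sum.inl x))).strictMono_of_injective ?_
    exact (π.injective.comp (e.injective.comp Sum.inl_injective)).comp ρ.injective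
  · ext1 z
    obtain ⟨x | y, rfl⟩ := e.surjective z
    · simp [blockMul_inl]
    · simp [blockMul_inr]

/-- Summing over permutations that are increasing on a block, and then over shuffles within that
block, amounts to summing over permutations increasing on the two parts of the block. -/
lemma sum_sum_blockMul {R β ι κ : Type*} [AddCommMonoid R] [LinearOrder ι] [LinearOrder κ]
    {p q : ℕ} (e : Fin p ⊕ β ≃ Fin q) (Q : (β → Fin q) → Prop) (i : ι → Fin p) (j : κ → Fin p)
    {S U : Finset (Equiv.Perm (Fin q))} {T : Finset (Equiv.Perm (Fin p))}
    (hS : ∀ σ, σ ∈ S ↔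
      StrictMono (fun x => σ (e (Sum.inl x))) ∧ Q (fun y => σ (e (Sum.inr y))))
    (hT : ∀ τ, τ ∈ T ↔ StrictMono (fun a => τ (i a)) ∧ StrictMono (fun b => τ (j b)))
    (hU : ∀ π, π ∈ U ↔ StrictMono (fun a => π (e (Sum.inl (i a)))) ∧
      StrictMono (fun b => π (e (Sum.inl (j b)))) ∧ Q (fun y => π (e (Sum.inr y))))
    (F : Equiv.Perm (Fin q) → R) :
    ∑ σ ∈ S, ∑ τ ∈ T, F (blockMul e σ τ) = ∑ π ∈ U, F π := by
  rw [← Finset.sum_product']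
  refine Finset.sum_nbij (fun x => blockMul e x.1 x.2) ?_ ?_ ?_ fun _ _ => rfl
  · rintro ⟨σ, τ⟩ h
    rw [Finset.mem_product, hS, hT] at h
    obtain ⟨⟨hσ, hQ⟩, hi, hj⟩ := h
    simp only [hU, blockMul_inl, blockMul_inr]
    exact ⟨hσ.comp hi, hσ.comp hj, hQ⟩
  · rintro ⟨σ, τ⟩ h ⟨σ', τ'⟩ h' heq
    rw [Finset.mem_coe, Finset.mem_product, hS] at h h'
    obtain ⟨rfl, rfl⟩ := blockMul_injective e h.1.1 h'.1.1 heq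
    rfl
  · intro π h
    obtain ⟨σ, τ, hσ, rfl⟩ := exists_blockMul_eq e π
    simp only [Finset.mem_coe, hU, blockMul_inl, blockMul_inr] at h
    refine ⟨(σ, τ), ?_, rfl⟩
    rw [Finset.mem_coe, Finset.mem_product, hS, hT]
    exact ⟨⟨hσ, h.2.2⟩, fun _ _ hab => hσ.lt_iff_lt.1 (h.1 hab),
      fun _ _ hab => hσ.lt_iff_lt.1 (h.2.1 hab)⟩

/-- The product of three functions and their pairwise kernels, evaluated on three blocks of
variables. -/
def tripleTerm {R X : Type*} [CommRing R] (φ : X × X → R) {n m k : ℕ}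
    (f : (Fin n → X) → R) (g : (Fin m → X) → R) (h : (Fin k → X) → R)
    (a : Fin n → X) (b : Fin m → X) (c : Fin k → X) : R :=
  f a * g b * h c * ((∏ s, ∏ t, φ (a s, b t)) * ∏ s, ∏ t, φ (a s, c t)) *
    ∏ s, ∏ t, φ (b s, c t)

lemma shuffleMul_shuffleMul_left {R X : Type*} [CommRing R] (φ : X × X → R) {n m k : ℕ}
    (f : (Fin n → X) → R) (g : (Fin m → X) → R) (h : (Fin k → X) → R)
    (lam : Fin (n + m + k) → X) :
    shuffleMul φ (shuffleMul φ f g) h lam =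
      ∑ π : Equiv.Perm (Fin (n + m + k)) with IsShuffle3 n m k π,
        tripleTerm φ f g h (fun s => lam (π (Fin.castAdd k (Fin.castAdd m s))))
          (fun t => lam (π (Fin.castAdd k (Fin.natAdd n t))))
          (fun u => lam (π (Fin.natAdd (n + m) u))) := by
  refine Eq.trans ?_ (sum_sum_blockMul finSumFinEquiv StrictMono (Fin.castAdd m) (Fin.natAdd n)
    (S := {σ | IsShuffle (n + m) k σ}) (T := {τ | IsShuffle n m τ}) (U := {π | IsShuffle3 n m k π})
    (fun _ => Finset.mem_filter_univ _) (fun _ => Finset.mem_filter_univ _)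
    (fun _ => Finset.mem_filter_univ _)
    fun π => tripleTerm φ f g h (fun s => lam (π (Fin.castAdd k (Fin.castAdd m s))))
          (fun t => lam (π (Fin.castAdd k (Fin.natAdd n t))))
          (fun u => lam (π (Fin.natAdd (n + m) u))))
  unfold shuffleMul
  refine Finset.sum_congr rfl fun σ _ => ?_
  rw [Finset.sum_mul, Finset.sum_mul]
  refine Finset.sum_congr rfl fun τ _ => ?_
  have hl := blockMul_inl (finSumFinEquiv (m := n + m) (n := k)) σ τ
  have hr := blockMul_inr (finSumFinEquiv (m := n + m) (n := k)) σ τ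
  simp only [finSumFinEquiv_apply_left, finSumFinEquiv_apply_right] at hl hr
  simp only [tripleTerm, hl, hr]
  rw [← Equiv.prod_comp τ, Fin.prod_univ_add]
  ring

lemma shuffleMul_shuffleMul_right {R X : Type*} [CommRing R] (φ : X × X → R) {n m k : ℕ}
    (f : (Fin n → X) → R) (g : (Fin m → X) → R) (h : (Fin k → X) → R)
    (lam : Fin (n + (m + k)) → X) :
    shuffleMul φ f (shuffleMul φ g h) lam =
      ∑ π : Equiv.Perm (Fin (n + (m + k))) with
          StrictMono (fun t => π (Fin.natAdd n (Fin.castAdd k t))) ∧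
          StrictMono (fun u => π (Fin.natAdd n (Fin.natAdd m u))) ∧
          StrictMono (fun s => π (Fin.castAdd (m + k) s)),
        tripleTerm φ f g h (fun s => lam (π (Fin.castAdd (m + k) s)))
          (fun t => lam (π (Fin.natAdd n (Fin.castAdd k t))))
          (fun u => lam (π (Fin.natAdd n (Fin.natAdd m u)))) := by
  let e := (Equiv.sumComm (Fin (m + k)) (Fin n)).trans finSumFinEquiv
  refine Eq.trans ?_ (sum_sum_blockMul e StrictMono (Fin.castAdd k) (Fin.natAdd m)
    (S := {σ | IsShuffle n (m + k) σ}) (T := {τ | IsShuffle m k τ})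
    (fun _ => (Finset.mem_filter_univ _).trans and_comm) (fun _ => Finset.mem_filter_univ _)
    (fun _ => Finset.mem_filter_univ _)
    fun π => tripleTerm φ f g h (fun s => lam (π (Fin.castAdd (m + k) s)))
          (fun t => lam (π (Fin.natAdd n (Fin.castAdd k t))))
          (fun u => lam (π (Fin.natAdd n (Fin.natAdd m u)))))
  unfold shuffleMul
  refine Finset.sum_congr rfl fun σ _ => ?_
  rw [Finset.mul_sum, Finset.sum_mul]
  refine Finset.sum_congr rfl fun τ _ => ?_
  have hl : ∀ x, blockMul e σ τ (Fin.natAdd n x) = σ (Fin.natAdd n (τ x)) := blockMul_inl e σ τ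
  have hr : ∀ y, blockMul e σ τ (Fin.castAdd (m + k) y) = σ (Fin.castAdd (m + k) y) :=
    blockMul_inr e σ τ
  simp only [tripleTerm, hl, hr]
  have hprod : ∀ s : Fin n,
      ∏ t, φ (lam (σ (Fin.castAdd (m + k) s)), lam (σ (Fin.natAdd n t))) =
        (∏ t, φ (lam (σ (Fin.castAdd (m + k) s)), lam (σ (Fin.natAdd n (τ (Fin.castAdd k t)))))) *
        ∏ t, φ (lam (σ (Fin.castAdd (m + k) s)), lam (σ (Fin.natAdd n (τ (Fin.natAdd m t))))) :=
    fun s => by rw [← Equiv.prod_comp τ, Fin.prod_univ_add]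
  simp only [hprod, Finset.prod_mul_distrib]
  ring

/-- Associativity of the kernel shuffle product, together with the explicit triple-shuffle
formula for both sides. -/
theorem shuffleMul_assoc {R X : Type*} [CommRing R] (φ : X × X → R) (n m k : ℕ)
    (f : (Fin n → X) → R) (g : (Fin m → X) → R) (h : (Fin k → X) → R) :
    (shuffleMul φ (shuffleMul φ f g) h =
      fun lam => shuffleMul φ f (shuffleMul φ g h)
        (fun i => lam (Fin.cast (Nat.add_assoc n m k).symm i))) ∧
    (shuffleMul φ (shuffleMul φ f g) h = fun lam =>
      ∑ π ∈ Finset.univ.filter (fun π : Equiv.Perm (Fin (n + m + k)) => IsShuffle3 n m k π),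
        f (fun s => lam (π (Fin.castAdd k (Fin.castAdd m s)))) *
        g (fun t => lam (π (Fin.castAdd k (Fin.natAdd n t)))) *
        h (fun u => lam (π (Fin.natAdd (n + m) u))) *
        (∏ s : Fin n, ∏ t : Fin (m + k),
          φ (lam (π (Fin.castAdd k (Fin.castAdd m s))),
             lam (π (Fin.cast (Nat.add_assoc n m k).symm (Fin.natAdd n t))))) *
        (∏ s : Fin m, ∏ t : Fin k,
          φ (lam (π (Fin.castAdd k (Fin.natAdd n s))),
             lam (π (Fin.natAdd (n + m) t))))) := by
  have hcast : ∀ t : Fin m, Fin.cast (Nat.add_assoc n m k).symm (Fin.natAdd n (Fin.castAdd k t)) =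
      Fin.castAdd k (Fin.natAdd n t) := fun _ => rfl
  have hnat : ∀ u : Fin k, Fin.cast (Nat.add_assoc n m k).symm (Fin.natAdd n (Fin.natAdd m u)) =
      Fin.natAdd (n + m) u := fun u => Fin.ext (Nat.add_assoc n m u).symm
  constructor
  · funext lam
    rw [shuffleMul_shuffleMul_left, shuffleMul_shuffleMul_right]
    let c := finCongr (Nat.add_assoc n m k)
    have hl : ∀ s : Fin n, c.symm (Fin.castAdd (m + k) s) = Fin.castAdd k (Fin.castAdd m s) :=
      fun _ => rfl
    have hc : ∀ t : Fin m, c.symm (Fin.natAdd n (Fin.castAdd k t)) =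
      Fin.castAdd k (Fin.natAdd n t) := hcast
    have hr : ∀ u : Fin k, c.symm (Fin.natAdd n (Fin.natAdd m u)) = Fin.natAdd (n + m) u := hnat
    refine Finset.sum_equiv c.permCongr (fun π => ?_) fun π _ => ?_
    · simp only [Finset.mem_filter, Finset.mem_univ, true_and, Equiv.permCongr_apply, hl, hc, hr]
      exact ⟨fun ⟨h₁, h₂, h₃⟩ => ⟨h₂, h₃, h₁⟩, fun ⟨h₂, h₃, h₁⟩ => ⟨h₁, h₂, h₃⟩⟩
    · simp only [Equiv.permCongr_apply, hl, hc, hr]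
      rfl
  · funext lam
    rw [shuffleMul_shuffleMul_left]
    refine Finset.sum_congr rfl fun π _ => ?_
    simp only [tripleTerm, Fin.prod_univ_add, hcast, hnat, Finset.prod_mul_distrib]
end
end

section
/- Let n, m be natural numbers, and let f ∈ ℂ[ħ, λ₁,…,λ_n] be symmetric in the variables λ₁,…,λ_n and g ∈ ℂ[ħ, λ₁,…,λ_m] be symmetric in the variables λ₁,…,λ_m. In the fraction field of the polynomial ring ℂ[ħ, λ₁,…,λ_{n+m}], the element f⋆g := Σ_{τ∈Sh(n,m)} f(λ_{τ(1)},…,λ_{τ(n)})·g(λ_{τ(n+1)},…,λ_{τ(n+m)})·∏_{s=1}^{n}∏_{t=n+1}^{n+m} (λ_{τ(s)} − λ_{τ(t)} + ħ)/(λ_{τ(t)} − λ_{τ(s)}) belongs to the subring ℂ[ħ, λ₁,…,λ_{n+m}] (i.e., all apparent poles along λ_s = λ_t cancel) and is symmetric in λ₁,…,λ_{n+m}. -/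
open scoped Classical
open MvPolynomial

noncomputable section

/-- The ring `ℂ[ħ, λ₁, …, λ_n]`, with `none` playing the role of the variable `ħ`
and `some i` the role of `λ_i`. -/
abbrev HPoly (n : ℕ) : Type := MvPolynomial (Option (Fin n)) ℂ

/-- The canonical map into the fraction field. -/
def embO (n : ℕ) : HPoly n →+* FractionRing (HPoly n) := algebraMap _ _

/-- The shuffle product of `f` and `g`, computed in the fraction field of
`ℂ[ħ, λ₁, …, λ_{n+m}]`, with kernel `(λ_s − λ_t + ħ)/(λ_t − λ_s)`. -/
def sl2ShuffleSum (n m : ℕ) (f : HPoly n) (g : HPoly m) : FractionRing (HPoly (n + m)) :=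
  ∑ τ ∈ Finset.univ.filter (fun τ : Equiv.Perm (Fin (n + m)) => IsShuffle n m τ),
    embO (n + m) (rename (Option.map fun s => τ (Fin.castAdd m s)) f) *
    embO (n + m) (rename (Option.map fun t => τ (Fin.natAdd n t)) g) *
    ∏ s : Fin n, ∏ t : Fin m,
      embO (n + m)
          (X (some (τ (Fin.castAdd m s))) - X (some (τ (Fin.natAdd n t))) + X none) /
      embO (n + m)
          (X (some (τ (Fin.natAdd n t))) - X (some (τ (Fin.castAdd m s))))

namespace MvPolynomial

variable {ι R : Type*} [DecidableEq ι] [CommRing R]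

theorem X_sub_X_dvd_sub_rename_update (i j : ι) (p : MvPolynomial ι R) :
    (X j - X i : MvPolynomial ι R) ∣ p - rename (Function.update id j i) p := by
  rw [← Ideal.mem_span_singleton, ← Ideal.Quotient.eq]
  let π := Ideal.Quotient.mkₐ R (Ideal.span {(X j - X i : MvPolynomial ι R)})
  have h : π = π.comp (rename (Function.update id j i)) := by
    ext k
    by_cases hk : k = j
    · subst hk
      simpa [π] using Ideal.Quotient.eq.2 (Ideal.mem_span_singleton_self _)
    · simp [hk]
  exact DFunLike.congr_fun h p

theorem X_sub_X_dvd_of_rename_swap_eq_neg [IsDomain R] [CharZero R] {i j : ι}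
    {p : MvPolynomial ι R} (hp : rename (Equiv.swap i j) p = -p) :
    (X j - X i : MvPolynomial ι R) ∣ p := by
  have hcomp : Function.update id j i ∘ Equiv.swap i j = Function.update id j i := by
    funext k
    by_cases hi : k = i
    · subst hi
      simp [Function.update_apply]
    · by_cases hj : k = j
      · subst hj
        simp [Function.update_apply]
      · simp [Equiv.swap_apply_of_ne_of_ne hi hj]
  have h : rename (Function.update id j i) p = 0 := by
    have := congrArg (rename (Function.update id j i)) hp
    rw [rename_rename, hcomp, map_neg] at this
    exact self_eq_neg.1 this
  simpa [h] using X_sub_X_dvd_sub_rename_update i j p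

theorem irreducible_X_sub_X [IsDomain R] {i j : ι} (hij : i ≠ j) :
    Irreducible (X j - X i : MvPolynomial ι R) := by
  have hcoeff : (X j - X i : MvPolynomial ι R).coeff (Finsupp.single j 1) = 1 := by
    simp [coeff_X, Finsupp.single_left_inj, hij]
  refine irreducible_of_totalDegree_eq_one (le_antisymm ?_ ?_) fun x hx ↦ ?_
  · exact (totalDegree_sub _ _).trans (by simp)
  · simpa using le_totalDegree (s := Finsupp.single j 1)
      (show _ ∈ (X j - X i : MvPolynomial ι R).support by simp [mem_support_iff, hcoeff])
  · exact isUnit_of_dvd_one (hcoeff ▸ hx _)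

theorem X_sub_X_dvd_X_sub_X [Nontrivial R] {i j k l : ι} (hkl : k ≠ l)
    (h : (X j - X i : MvPolynomial ι R) ∣ X l - X k) :
    (i = k ∧ j = l) ∨ (i = l ∧ j = k) := by
  have h0 : (if l = j then i else l) = if k = j then i else k := by
    have := map_dvd (rename (R := R) (Function.update id j i)) h
    simp only [map_sub, rename_X, Function.update_self, Function.update_apply] at this
    simp only [id, ite_self, sub_self, zero_dvd_iff, sub_eq_zero] at this
    exact X_injective this
  split_ifs at h0 <;> grind

/-- An alternating polynomial in a family of variables is divisible by their Vandermonde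
determinant. -/
theorem det_vandermonde_X_dvd [IsDomain R] [UniqueFactorizationMonoid R] [CharZero R] {N : ℕ} {e : Fin N → ι}
    (he : Function.Injective e) {p : MvPolynomial ι R}
    (hp : ∀ i j, i ≠ j → rename (Equiv.swap (e i) (e j)) p = -p) :
    (Matrix.vandermonde fun i ↦ (X (e i) : MvPolynomial ι R)).det ∣ p := by
  rw [Matrix.det_vandermonde, Finset.prod_sigma']
  refine Finset.prod_dvd_of_isRelPrime ?_ ?_
  · rintro ⟨i, j⟩ hij ⟨k, l⟩ hkl hne
    have hij : i < j := by simpa using hij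
    have hkl : k < l := by simpa using hkl
    refine (irreducible_X_sub_X (he.ne hij.ne)).isRelPrime_iff_not_dvd.2 fun h ↦ ?_
    rcases X_sub_X_dvd_X_sub_X (he.ne hkl.ne) h with ⟨h₁, h₂⟩ | ⟨h₁, h₂⟩
    · exact hne (by rw [he h₁, he h₂])
    · rw [he h₁, he h₂] at hij
      exact hij.asymm hkl
  · rintro ⟨i, j⟩ hij
    have hij : i < j := by simpa using hij
    exact X_sub_X_dvd_of_rename_swap_eq_neg (hp i j hij.ne)

end MvPolynomial

theorem Matrix.det_vandermonde_comp_perm {R : Type*} [CommRing R] {N : ℕ} (v : Fin N → R)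
    (σ : Equiv.Perm (Fin N)) :
    (vandermonde (v ∘ σ)).det = (Equiv.Perm.sign σ : ℤ) * (vandermonde v).det := by
  rw [← det_permute]
  rfl

theorem Matrix.det_vandermonde_add_blocks {R : Type*} [CommRing R] {n m : ℕ}
    (v : Fin (n + m) → R) :
    (vandermonde v).det =
      (∏ s : Fin n, ∏ t : Fin m, (v (Fin.natAdd n t) - v (Fin.castAdd m s))) *
        ((vandermonde fun s ↦ v (Fin.castAdd m s)).det *
          (vandermonde fun t ↦ v (Fin.natAdd n t)).det) := by
  have h {k : ℕ} (w : Fin k → R) :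
      (vandermonde w).det = ∏ i, ∏ j, if i < j then w j - w i else 1 := by
    rw [det_vandermonde]
    refine Finset.prod_congr rfl fun i _ ↦ ?_
    rw [← Finset.prod_filter]
    congr 1
    ext j
    simp
  have hlt (s : Fin n) (t : Fin m) : Fin.castAdd m s < Fin.natAdd n t := by
    simp only [Fin.lt_def, Fin.val_castAdd, Fin.val_natAdd]
    omega
  simp only [h, Fin.prod_univ_add, hlt, (hlt _ _).asymm, if_true, if_false, Finset.prod_const_one,
    Finset.prod_mul_distrib, (Fin.strictMono_castAdd m).lt_iff_lt, Fin.natAdd_lt_natAdd_iff]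
  ring

/-- The permutation of `Fin (n + m)` acting by `a` on the first block and by `b` on the second. -/
def blockPerm {n m : ℕ} (a : Equiv.Perm (Fin n)) (b : Equiv.Perm (Fin m)) :
    Equiv.Perm (Fin (n + m)) :=
  finSumFinEquiv.permCongr (Equiv.sumCongr a b)

section blockPerm

variable {n m : ℕ} (a : Equiv.Perm (Fin n)) (b : Equiv.Perm (Fin m))

@[simp]
theorem blockPerm_castAdd (s : Fin n) :
    blockPerm a b (Fin.castAdd m s) = Fin.castAdd m (a s) := by
  simp [blockPerm, Equiv.permCongr_apply]

@[simp]
theorem blockPerm_natAdd (t : Fin m) :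
    blockPerm a b (Fin.natAdd n t) = Fin.natAdd n (b t) := by
  simp [blockPerm, Equiv.permCongr_apply]

theorem blockPerm_mul_symm : blockPerm a b * blockPerm a.symm b.symm = 1 := by
  ext i
  refine Fin.addCases (fun s ↦ ?_) (fun t ↦ ?_) i <;> simp

end blockPerm

/-- Every permutation factors uniquely as a shuffle followed by a block permutation. -/
theorem bijective_shuffle_mul_blockPerm (n m : ℕ) :
    Function.Bijective fun x : {τ : Equiv.Perm (Fin (n + m)) // IsShuffle n m τ} ×
      (Equiv.Perm (Fin n) × Equiv.Perm (Fin m)) ↦ x.1.1 * blockPerm x.2.1 x.2.2 := by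
  constructor
  · rintro ⟨⟨τ, hτ⟩, a, b⟩ ⟨⟨τ', hτ'⟩, a', b'⟩ h
    have h₁ (s) : τ (Fin.castAdd m (a s)) = τ' (Fin.castAdd m (a' s)) := by
      simpa using DFunLike.congr_fun h (Fin.castAdd m s)
    have h₂ (t) : τ (Fin.natAdd n (b t)) = τ' (Fin.natAdd n (b' t)) := by
      simpa using DFunLike.congr_fun h (Fin.natAdd n t)
    have e₁ := (hτ.1.range_inj hτ'.1).1 (by
      rw [← a.surjective.range_comp, ← a'.surjective.range_comp fun i ↦ τ' (Fin.castAdd m i)]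
      exact congrArg Set.range (_root_.funext h₁))
    have e₂ := (hτ.2.range_inj hτ'.2).1 (by
      rw [← b.surjective.range_comp, ← b'.surjective.range_comp fun i ↦ τ' (Fin.natAdd n i)]
      exact congrArg Set.range (_root_.funext h₂))
    have hττ' : τ = τ' := by
      ext i
      refine Fin.addCases (fun s ↦ ?_) (fun t ↦ ?_) i
      · rw [congrFun e₁ s]
      · rw [congrFun e₂ t]
    subst hττ'
    have ha : a = a' := Equiv.ext fun s ↦ by simpa using h₁ s
    have hb : b = b' := Equiv.ext fun t ↦ by simpa using h₂ t
    rw [ha, hb]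
  · intro τ
    let a := Tuple.sort fun s ↦ τ (Fin.castAdd m s)
    let b := Tuple.sort fun t ↦ τ (Fin.natAdd n t)
    refine ⟨⟨⟨τ * blockPerm a b, ?_, ?_⟩, a.symm, b.symm⟩, ?_⟩
    · simp only [Equiv.Perm.mul_apply, blockPerm_castAdd]
      exact (Tuple.monotone_sort fun s ↦ τ (Fin.castAdd m s)).strictMono_of_injective
        ((τ.injective.comp (Fin.castAdd_injective n m)).comp a.injective)
    · simp only [Equiv.Perm.mul_apply, blockPerm_natAdd]
      exact (Tuple.monotone_sort fun t ↦ τ (Fin.natAdd n t)).strictMono_of_injective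
        ((τ.injective.comp (Fin.natAdd_injective m n)).comp b.injective)
    · simp only [mul_assoc, blockPerm_mul_symm, mul_one]

theorem sum_perm_eq_factorial_mul_sum_shuffle {K : Type*} [CommRing K] {n m : ℕ}
    (F : Equiv.Perm (Fin (n + m)) → K) (hF : ∀ τ a b, F (τ * blockPerm a b) = F τ) :
    ∑ τ, F τ = ((n.factorial * m.factorial : ℕ) : K) *
      ∑ τ ∈ Finset.univ.filter (fun τ => IsShuffle n m τ), F τ := by
  rw [← (bijective_shuffle_mul_blockPerm n m).sum_comp F, Fintype.sum_prod_type]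
  simp only [hF, Finset.sum_const, Finset.card_univ, Fintype.card_prod, Fintype.card_perm,
    Fintype.card_fin, nsmul_eq_mul, ← Finset.mul_sum]
  rw [← Finset.sum_subtype (p := IsShuffle n m)
    (Finset.univ.filter fun τ => IsShuffle n m τ) (by simp) F]

/-- The summand of the shuffle product, for an arbitrary permutation. -/
def shuffleTerm {n m : ℕ} (f : HPoly n) (g : HPoly m) (τ : Equiv.Perm (Fin (n + m))) :
    FractionRing (HPoly (n + m)) :=
  embO (n + m) (rename (Option.map fun s => τ (Fin.castAdd m s)) f) *
    embO (n + m) (rename (Option.map fun t => τ (Fin.natAdd n t)) g) *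
    ∏ s : Fin n, ∏ t : Fin m,
      embO (n + m)
          (X (some (τ (Fin.castAdd m s))) - X (some (τ (Fin.natAdd n t))) + X none) /
      embO (n + m)
          (X (some (τ (Fin.natAdd n t))) - X (some (τ (Fin.castAdd m s))))

theorem rename_option_map_comp_perm {k : ℕ} {α : Type*} {f : HPoly k}
    (hf : ∀ σ : Equiv.Perm (Fin k), rename (Equiv.optionCongr σ) f = f)
    (u : Fin k → α) (a : Equiv.Perm (Fin k)) :
    rename (Option.map fun s => u (a s)) f = rename (Option.map u) f := by
  conv_rhs => rw [← hf a, rename_rename]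
  congr 2
  funext o
  cases o <;> rfl

theorem shuffleTerm_mul_blockPerm {n m : ℕ} {f : HPoly n} {g : HPoly m}
    (hf : ∀ σ : Equiv.Perm (Fin n), rename (Equiv.optionCongr σ) f = f)
    (hg : ∀ σ : Equiv.Perm (Fin m), rename (Equiv.optionCongr σ) g = g)
    (τ : Equiv.Perm (Fin (n + m))) (a : Equiv.Perm (Fin n)) (b : Equiv.Perm (Fin m)) :
    shuffleTerm f g (τ * blockPerm a b) = shuffleTerm f g τ := by
  simp only [shuffleTerm, Equiv.Perm.mul_apply, blockPerm_castAdd, blockPerm_natAdd]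
  rw [rename_option_map_comp_perm hf (fun s ↦ τ (Fin.castAdd m s)),
    rename_option_map_comp_perm hg (fun t ↦ τ (Fin.natAdd n t))]
  congr 1
  exact Fintype.prod_equiv a _ _ fun s ↦ Fintype.prod_equiv b _ _ fun t ↦ rfl

/-- The Vandermonde determinant in `λ₁, …, λ_N`. -/
def hVandermonde (N : ℕ) : HPoly N :=
  (Matrix.vandermonde fun i : Fin N ↦ (X (some i) : HPoly N)).det

theorem rename_hVandermonde {N : ℕ} (σ : Equiv.Perm (Fin N)) :
    rename (Equiv.optionCongr σ) (hVandermonde N) =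
      (Equiv.Perm.sign σ : ℤ) * hVandermonde N := by
  rw [hVandermonde, ← Matrix.det_vandermonde_comp_perm, AlgHom.map_det]
  congr 1
  ext1 i j
  simp [Matrix.vandermonde_apply]

theorem hVandermonde_ne_zero (N : ℕ) : hVandermonde N ≠ 0 :=
  Matrix.det_vandermonde_ne_zero_iff.2 ((X_injective).comp (Option.some_injective _))

/-- The numerator of the summand at the identity over the full Vandermonde determinant. -/
def shuffleNumerator {n m : ℕ} (f : HPoly n) (g : HPoly m) : HPoly (n + m) :=
  rename (Option.map (Fin.castAdd m)) f * rename (Option.map (Fin.natAdd n)) g *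
    (∏ s : Fin n, ∏ t : Fin m,
      (X (some (Fin.castAdd m s)) - X (some (Fin.natAdd n t)) + X none)) *
    ((Matrix.vandermonde fun s : Fin n ↦ (X (some (Fin.castAdd m s)) : HPoly (n + m))).det *
      (Matrix.vandermonde fun t : Fin m ↦ (X (some (Fin.natAdd n t)) : HPoly (n + m))).det)

theorem embO_hVandermonde_mul_shuffleTerm {n m : ℕ} (f : HPoly n) (g : HPoly m)
    (τ : Equiv.Perm (Fin (n + m))) :
    embO (n + m) (hVandermonde (n + m)) * shuffleTerm f g τ =
      embO (n + m) ((Equiv.Perm.sign τ : ℤ) *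
        rename (Equiv.optionCongr τ) (shuffleNumerator f g)) := by
  have hΔ : hVandermonde (n + m) = (Equiv.Perm.sign τ : ℤ) *
      (Matrix.vandermonde ((fun i ↦ (X (some i) : HPoly (n + m))) ∘ τ)).det := by
    rw [Matrix.det_vandermonde_comp_perm, ← mul_assoc, ← Int.cast_mul, ← Units.val_mul,
      Int.units_mul_self]
    simp [hVandermonde]
  have hD : embO (n + m) (∏ s : Fin n, ∏ t : Fin m,
      (X (some (τ (Fin.natAdd n t))) - X (some (τ (Fin.castAdd m s))))) ≠ 0 := by
    refine (map_ne_zero_iff _ (IsFractionRing.injective _ _)).2 ?_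
    simp only [Finset.prod_ne_zero_iff, sub_ne_zero]
    intro s _ t _ h
    have := τ.injective (Option.some_injective _ (X_injective h))
    simp only [Fin.ext_iff, Fin.val_castAdd, Fin.val_natAdd] at this
    omega
  have hcomp {k : ℕ} (u : Fin k → Fin (n + m)) :
      Equiv.optionCongr τ ∘ Option.map u = Option.map fun i ↦ τ (u i) := by
    funext o
    cases o <;> rfl
  have hR : rename (Equiv.optionCongr τ) (shuffleNumerator f g) =
      rename (Option.map fun s => τ (Fin.castAdd m s)) f *
      rename (Option.map fun t => τ (Fin.natAdd n t)) g *
      (∏ s : Fin n, ∏ t : Fin m,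
        (X (some (τ (Fin.castAdd m s))) - X (some (τ (Fin.natAdd n t))) + X none)) *
      ((Matrix.vandermonde fun s : Fin n ↦
          (X (some (τ (Fin.castAdd m s))) : HPoly (n + m))).det *
        (Matrix.vandermonde fun t : Fin m ↦
          (X (some (τ (Fin.natAdd n t))) : HPoly (n + m))).det) := by
    simp only [shuffleNumerator, map_mul, map_prod, map_add, map_sub, rename_X, rename_rename,
      Matrix.det_vandermonde, Equiv.optionCongr_apply, Option.map_some, Option.map_none,
      hcomp]
  rw [hΔ, hR, Matrix.det_vandermonde_add_blocks, shuffleTerm]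
  simp only [Finset.prod_div_distrib, ← map_prod]
  simp only [map_mul, Function.comp_apply]
  field_simp

theorem rename_sum_sign_mul_rename {N : ℕ} (q : HPoly N) (σ : Equiv.Perm (Fin N)) :
    rename (Equiv.optionCongr σ) (∑ τ : Equiv.Perm (Fin N),
        ((Equiv.Perm.sign τ : ℤ) : HPoly N) * rename (Equiv.optionCongr τ) q) =
      (Equiv.Perm.sign σ : ℤ) * ∑ τ : Equiv.Perm (Fin N),
        ((Equiv.Perm.sign τ : ℤ) : HPoly N) * rename (Equiv.optionCongr τ) q := by
  rw [map_sum, Finset.mul_sum]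
  refine Fintype.sum_equiv (Equiv.mulLeft σ) _ _ fun τ ↦ ?_
  rw [Equiv.coe_mulLeft, Equiv.Perm.sign_mul, Units.val_mul, Int.cast_mul, ← mul_assoc,
    ← mul_assoc, ← Int.cast_mul, ← Units.val_mul, Int.units_mul_self, map_mul, map_intCast,
    rename_rename]
  simp only [Units.val_one, Int.cast_one, one_mul]
  congr 3
  funext o
  cases o <;> rfl

/-- The shuffle product of two symmetric polynomials is a (symmetric) polynomial:
all apparent poles along `λ_s = λ_t` cancel. -/
theorem sl2_shuffle_polynomial_and_symmetric (n m : ℕ) (f : HPoly n) (g : HPoly m)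
    (hf : ∀ σ : Equiv.Perm (Fin n), rename (⇑(Equiv.optionCongr σ)) f = f)
    (hg : ∀ σ : Equiv.Perm (Fin m), rename (⇑(Equiv.optionCongr σ)) g = g) :
    ∃ p : HPoly (n + m),
      (∀ σ : Equiv.Perm (Fin (n + m)), rename (⇑(Equiv.optionCongr σ)) p = p) ∧
      embO (n + m) p = sl2ShuffleSum n m f g := by
  set A : HPoly (n + m) := ∑ τ : Equiv.Perm (Fin (n + m)),
    (Equiv.Perm.sign τ : ℤ) * rename (Equiv.optionCongr τ) (shuffleNumerator f g) with hA
  have hAσ (σ : Equiv.Perm (Fin (n + m))) :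
      rename (Equiv.optionCongr σ) A = (Equiv.Perm.sign σ : ℤ) * A :=
    rename_sum_sign_mul_rename _ σ
  obtain ⟨q, hq⟩ : hVandermonde (n + m) ∣ A := by
    refine det_vandermonde_X_dvd (Option.some_injective _) fun i j hij ↦ ?_
    rw [← Equiv.optionCongr_swap, hAσ, Equiv.Perm.sign_swap hij]
    simp
  have hqσ (σ : Equiv.Perm (Fin (n + m))) : rename (Equiv.optionCongr σ) q = q := by
    have h := hAσ σ
    rw [hq, map_mul, rename_hVandermonde, mul_assoc] at h
    have hsign : ((Equiv.Perm.sign σ : ℤ) : HPoly (n + m)) ≠ 0 := by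
      exact_mod_cast (Equiv.Perm.sign σ).ne_zero
    exact mul_left_cancel₀ (hVandermonde_ne_zero _) (mul_left_cancel₀ hsign h)
  have hsum : embO (n + m) q =
      ((n.factorial * m.factorial : ℕ) : FractionRing (HPoly (n + m))) *
        sl2ShuffleSum n m f g := by
    have hΔ : embO (n + m) (hVandermonde (n + m)) ≠ 0 :=
      (map_ne_zero_iff _ (IsFractionRing.injective _ _)).2 (hVandermonde_ne_zero _)
    refine mul_left_cancel₀ hΔ ?_
    rw [← map_mul, ← hq, hA, map_sum]
    simp only [← embO_hVandermonde_mul_shuffleTerm]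
    rw [← Finset.mul_sum,
      sum_perm_eq_factorial_mul_sum_shuffle _ (shuffleTerm_mul_blockPerm hf hg)]
    rfl
  have hc : ((n.factorial * m.factorial : ℕ) : ℂ) ≠ 0 := by
    exact_mod_cast mul_ne_zero n.factorial_ne_zero m.factorial_ne_zero
  refine ⟨C ((n.factorial * m.factorial : ℕ) : ℂ)⁻¹ * q, fun σ ↦ ?_, ?_⟩
  · rw [map_mul, rename_C, hqσ]
  · rw [map_mul, hsum, ← map_natCast (embO (n + m)), ← map_natCast (C (σ := Option (Fin (n + m)))),
      ← mul_assoc, ← map_mul, ← map_mul, inv_mul_cancel₀ hc, map_one, map_one, one_mul]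
end
end
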